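/- Let S be a finite set of points in the plane with distinct y-coordinates, in general position, with lowest point p_s and highest point p_t, and |S| = n ≥ 3. For every integer m with |E_L| ≤ m ≤ n - |E_R| + 2, where E_L and E_R are the left and right envelopes of S (each counted including p_s and p_t), there exists a non-crossing monotone Hamiltonian cycle on S whose left path uses exactly m points of S (including p_s and p_t). -/

import Mathlib

open scoped BigOperators

abbrev Pt : Type := ℝ × ℝ

noncomputable section

/-- Signed cross product: positive iff `b` is strictly left of the directed line `o → a`. -/
def xprod (o a b : Pt) : ℝ := (a.1 - o.1) * (b.2 - o.2) - (a.2 - o.2) * (b.1 - o.1)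

/-- Closed straight-line segment between two points. -/
def Seg (p q : Pt) : Set Pt := segment ℝ p q

/-- Consecutive edges of a polyline given by a list of points. -/
def edgesOf (l : List Pt) : List (Pt × Pt) := l.zip l.tail

/-- The set of points covered by a polyline. -/
def polyPts (l : List Pt) : Set Pt := ⋃ e ∈ edgesOf l, Seg e.1 e.2

/-- A polyline is y-monotone: strictly increasing y-coordinates. -/
def MonoPath (l : List Pt) : Prop := l.Chain' (fun p q => p.2 < q.2)

/-- Two segments do not cross: any common point is an endpoint of both. -/
def SegNC (e f : Pt × Pt) : Prop :=
  ∀ x : Pt, x ∈ Seg e.1 e.2 → x ∈ Seg f.1 f.2 →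
    (x = e.1 ∨ x = e.2) ∧ (x = f.1 ∨ x = f.2)

/-- No two distinct segments among the edges of the two polylines cross. -/
def PolyNC (L R : List Pt) : Prop :=
  ∀ e ∈ edgesOf L ++ edgesOf R, ∀ f ∈ edgesOf L ++ edgesOf R, e ≠ f → SegNC e f

/-- The polyline `L` is (weakly) to the left of `R` at every intermediate height. -/
def LeftOf (L R : List Pt) (ps pt : Pt) : Prop :=
  ∀ p ∈ polyPts L, ∀ q ∈ polyPts R, p.2 = q.2 → ps.2 < p.2 → p.2 < pt.2 → p.1 < q.1

/-- All points of `S` have pairwise distinct y-coordinates. -/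
def DistinctY (S : Finset Pt) : Prop := ∀ p ∈ S, ∀ q ∈ S, p.2 = q.2 → p = q

/-- General position: no three distinct points of `S` are collinear. -/
def GenPos (S : Finset Pt) : Prop :=
  ∀ p ∈ S, ∀ q ∈ S, ∀ r ∈ S, p ≠ q → p ≠ r → q ≠ r → xprod p q r ≠ 0

def IsLowest (S : Finset Pt) (p : Pt) : Prop := p ∈ S ∧ ∀ q ∈ S, q ≠ p → p.2 < q.2

def IsHighest (S : Finset Pt) (p : Pt) : Prop := p ∈ S ∧ ∀ q ∈ S, q ≠ p → q.2 < p.2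

/-- Points of `S` on the boundary of the convex hull of `S`. -/
def hullPts (S : Finset Pt) : Set Pt :=
  {p | p ∈ S ∧ p ∈ frontier (convexHull ℝ (S : Set Pt))}

/-- The left envelope: hull-boundary points of `S` on or to the left of the line `ps pt`. -/
def leftEnvelope (S : Finset Pt) (ps pt : Pt) : Set Pt :=
  {p ∈ hullPts S | 0 ≤ xprod ps pt p}

/-- The right envelope: hull-boundary points of `S` on or to the right of the line `ps pt`. -/
def rightEnvelope (S : Finset Pt) (ps pt : Pt) : Set Pt :=
  {p ∈ hullPts S | xprod ps pt p ≤ 0}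

/-- A non-crossing monotone Hamiltonian cycle on `S`, given by its two monotone
paths `L` and `R` from the lowest point `ps` to the highest point `pt`. -/
structure IsNCMonoHamCycle (S : Finset Pt) (ps pt : Pt) (L R : List Pt) : Prop where
  monoL : MonoPath L
  monoR : MonoPath R
  headL : L.head? = some ps
  headR : R.head? = some ps
  lastL : L.getLast? = some pt
  lastR : R.getLast? = some pt
  nodupL : L.Nodup
  nodupR : R.Nodup
  cover : ∀ p : Pt, p ∈ S ↔ (p ∈ L ∨ p ∈ R)
  shared : ∀ p : Pt, p ∈ L → p ∈ R → p = ps ∨ p = pt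
  noncross : PolyNC L R

/-- An upward planar straight-line embedding of the digraph `(V, E)` on the pointset `S`. -/
structure IsUPSE {V : Type} (E : V → V → Prop) (S : Finset Pt) (f : V → Pt) : Prop where
  bij : Set.BijOn f Set.univ (S : Set Pt)
  upward : ∀ u v : V, E u v → (f u).2 < (f v).2
  planar : ∀ u v w z : V, E u v → E w z → (u, v) ≠ (w, z) → SegNC (f u, f v) (f w, f z)

/-- Undirected reachability in a digraph. -/
def UReach {V : Type} (E : V → V → Prop) (a b : V) : Prop :=
  Relation.ReflTransGen (fun x y => E x y ∨ E y x) a b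

/-- The digraph `E` with the edges of `W` removed. -/
def AvoidW {V : Type} (E : V → V → Prop) (W : Set (V × V)) : V → V → Prop :=
  fun a b => E a b ∧ (a, b) ∉ W

/-- `W` is an st-cutset: removing `W` leaves exactly two undirected components,
one containing `s` and one containing `t`, and every edge of `W` goes from the
`s`-side to the `t`-side. -/
def IsSTCutset {V : Type} (E : V → V → Prop) (s t : V) (W : Set (V × V)) : Prop :=
  (∀ e ∈ W, E e.1 e.2) ∧
  (∀ v : V, UReach (AvoidW E W) s v ∨ UReach (AvoidW E W) t v) ∧
  ¬ UReach (AvoidW E W) s t ∧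
  (∀ e ∈ W, UReach (AvoidW E W) s e.1 ∧ UReach (AvoidW E W) t e.2)

/-- A bipath on `Si`: two non-crossing monotone paths starting at `p1`,
internally disjoint, together covering `Si`, with `L` to the left of `R`. -/
structure IsBipath (Si : Finset Pt) (p1 : Pt) (L R : List Pt) : Prop where
  monoL : MonoPath L
  monoR : MonoPath R
  headL : L.head? = some p1
  headR : R.head? = some p1
  nodupL : L.Nodup
  nodupR : R.Nodup
  cover : ∀ p : Pt, p ∈ Si ↔ (p ∈ L ∨ p ∈ R)
  shared : ∀ p : Pt, p ∈ L → p ∈ R → p = p1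
  noncross : PolyNC L R
  leftOf : ∀ p ∈ polyPts L, ∀ q ∈ polyPts R, p.2 = q.2 → p1.2 < p.2 → p ≠ q → p.1 < q.1

/-- The bipath `(L, R)` on `Si` extends to the non-crossing monotone Hamiltonian
cycle `(L', R')` on `S`, i.e. the restriction of the cycle to `Si` is `(L, R)`. -/
def ExtendsTo (S Si : Finset Pt) (ps pt : Pt) (L R L' R' : List Pt) : Prop :=
  IsNCMonoHamCycle S ps pt L' R' ∧
  L <+: L' ∧ R <+: R' ∧
  (∀ p ∈ L', p ∈ Si ↔ p ∈ L) ∧ (∀ p ∈ R', p ∈ Si ↔ p ∈ R)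

end


/-- Consecutive (in height) points of a finite set. -/
def Cons (A : Finset Pt) (a b : Pt) : Prop :=
  a ∈ A ∧ b ∈ A ∧ a.2 < b.2 ∧ ∀ c ∈ A, a.2 < c.2 → c.2 < b.2 → False

/-- Standing assumptions. -/
structure Cfg (S : Finset Pt) (ps pt : Pt) : Prop where
  hy : DistinctY S
  hgp : GenPos S
  hs : IsLowest S ps
  ht : IsHighest S pt

/-- Combinatorial description of a valid partition. -/
structure Good (S : Finset Pt) (ps pt : Pt) (A B : Finset Pt) : Prop where
  cover : ∀ p, p ∈ S ↔ p ∈ A ∨ p ∈ B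
  sA : ps ∈ A
  sB : ps ∈ B
  tA : pt ∈ A
  tB : pt ∈ B
  shared : ∀ p, p ∈ A → p ∈ B → p = ps ∨ p = pt
  hA : ∀ a b, Cons A a b → ∀ v ∈ B, a.2 < v.2 → v.2 < b.2 → xprod a b v < 0
  hB : ∀ a b, Cons B a b → ∀ v ∈ A, a.2 < v.2 → v.2 < b.2 → 0 < xprod a b v

theorem xprod_interp (o a p q u : Pt) :
    (q.2 - p.2) * xprod o a u = (q.2 - u.2) * xprod o a p + (u.2 - p.2) * xprod o a q
      + (a.2 - o.2) * xprod p q u := by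
  unfold xprod; ring

theorem xprod_self_left (o a : Pt) : xprod o a o = 0 := by unfold xprod; ring
theorem xprod_self_right (o a : Pt) : xprod o a a = 0 := by unfold xprod; ring

theorem exists_low (A : Finset Pt) (y : ℝ) (h : ∃ c ∈ A, c.2 < y) :
    ∃ a ∈ A, a.2 < y ∧ ∀ c ∈ A, c.2 < y → c.2 ≤ a.2 := by
  obtain ⟨c, hc, hcy⟩ := h
  obtain ⟨a, ha, hmax⟩ := Finset.exists_max_image (A.filter (fun c => c.2 < y)) (fun c => c.2)
    ⟨c, by simp [hc, hcy]⟩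
  simp only [Finset.mem_filter] at ha hmax
  exact ⟨a, ha.1, ha.2, fun c hc h => hmax c ⟨hc, h⟩⟩

theorem exists_up (A : Finset Pt) (y : ℝ) (h : ∃ c ∈ A, y < c.2) :
    ∃ a ∈ A, y < a.2 ∧ ∀ c ∈ A, y < c.2 → a.2 ≤ c.2 := by
  obtain ⟨c, hc, hcy⟩ := h
  obtain ⟨a, ha, hmax⟩ := Finset.exists_min_image (A.filter (fun c => y < c.2)) (fun c => c.2)
    ⟨c, by simp [hc, hcy]⟩
  simp only [Finset.mem_filter] at ha hmax
  exact ⟨a, ha.1, ha.2, fun c hc h => hmax c ⟨hc, h⟩⟩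

theorem exists_consPred (A : Finset Pt) (v : Pt) (hv : v ∈ A) (h : ∃ c ∈ A, c.2 < v.2) :
    ∃ p, Cons A p v := by
  obtain ⟨a, ha, h1, h2⟩ := exists_low A v.2 h
  exact ⟨a, ha, hv, h1, fun c hc h3 h4 => absurd (h2 c hc h4) (not_le.2 h3)⟩

theorem exists_consSucc (A : Finset Pt) (v : Pt) (hv : v ∈ A) (h : ∃ c ∈ A, v.2 < c.2) :
    ∃ q, Cons A v q := by
  obtain ⟨a, ha, h1, h2⟩ := exists_up A v.2 h
  exact ⟨a, hv, ha, h1, fun c hc h3 h4 => absurd (h2 c hc h3) (not_le.2 h4)⟩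

/-- A local maximum of an `xprod` functional along a chain is a left-pointing vertex. -/
theorem reflex_of_max {S : Finset Pt} {ps pt : Pt} (C : Cfg S ps pt) {o a p u q : Pt}
    (hp : p ∈ S) (hu : u ∈ S) (hq : q ∈ S) (hoa : o.2 < a.2) (h1 : p.2 < u.2) (h2 : u.2 < q.2)
    (hfp : xprod o a p ≤ xprod o a u) (hfq : xprod o a q ≤ xprod o a u) :
    0 < xprod p q u := by
  have hne : xprod p q u ≠ 0 := by
    apply C.hgp p hp q hq u hu
    · rintro rfl; linarith
    · rintro rfl; linarith
    · rintro rfl; linarith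
  have hI := xprod_interp o a p q u
  have : 0 ≤ (a.2 - o.2) * xprod p q u := by
    nlinarith [mul_nonneg (sub_nonneg.2 h2.le) (sub_nonneg.2 hfp),
      mul_nonneg (sub_nonneg.2 h1.le) (sub_nonneg.2 hfq)]
  exact lt_of_le_of_ne (nonneg_of_mul_nonneg_right this (by linarith)) hne.symm

/-- Left-pointing vertex of the chain `B`. -/
def Reflex (B : Finset Pt) (p v q : Pt) : Prop := Cons B p v ∧ Cons B v q ∧ 0 < xprod p q v

theorem Good.memA {S A B : Finset Pt} {ps pt : Pt} (G : Good S ps pt A B) {p : Pt} (h : p ∈ A) :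
    p ∈ S := (G.cover p).2 (Or.inl h)
theorem Good.memB {S A B : Finset Pt} {ps pt : Pt} (G : Good S ps pt A B) {p : Pt} (h : p ∈ B) :
    p ∈ S := (G.cover p).2 (Or.inr h)

theorem Cfg.le_low {S : Finset Pt} {ps pt : Pt} (C : Cfg S ps pt) {p : Pt} (h : p ∈ S) :
    ps.2 ≤ p.2 := by
  by_cases e : p = ps
  · rw [e]
  · exact (C.hs.2 p h e).le
theorem Cfg.le_high {S : Finset Pt} {ps pt : Pt} (C : Cfg S ps pt) {p : Pt} (h : p ∈ S) :
    p.2 ≤ pt.2 := by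
  by_cases e : p = pt
  · rw [e]
  · exact (C.ht.2 p h e).le

theorem step_low {S A B : Finset Pt} {ps pt : Pt} (C : Cfg S ps pt) (G : Good S ps pt A B)
    {a b v : Pt} (hab : Cons A a b) (hv : v ∈ B) (hav : a.2 < v.2) (hvb : v.2 < b.2)
    (hmax : ∀ p w q, Reflex B p w q → a.2 < w.2 → w.2 < b.2 → xprod a b w ≤ xprod a b v) :
    ∀ w ∈ B, a.2 < w.2 → w.2 < v.2 → xprod a v w < 0 := by
  by_contra! hcon
  obtain ⟨w0, hw0, hw01, hw02, hw03⟩ := hcon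
  obtain ⟨w, hw, hwm⟩ := Finset.exists_max_image (B.filter (fun c => a.2 < c.2 ∧ c.2 < v.2))
    (fun c => xprod a v c) ⟨w0, by simp [hw0, hw01, hw02]⟩
  simp only [Finset.mem_filter] at hw hwm
  obtain ⟨hwB, haw, hwv⟩ := hw
  have hw0' : 0 ≤ xprod a v w := hw03.trans (hwm w0 ⟨hw0, hw01, hw02⟩)
  have hpos : 0 < xprod a v w := by
    refine lt_of_le_of_ne hw0' (Ne.symm ?_)
    apply C.hgp a (G.memA hab.1) v (G.memB hv) w (G.memB hwB)
    · rintro rfl; linarith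
    · rintro rfl; linarith
    · rintro rfl; linarith
  have hps : ps.2 ≤ a.2 := C.le_low (G.memA hab.1)
  obtain ⟨p, hp⟩ := exists_consPred B w hwB ⟨ps, G.sB, by linarith⟩
  obtain ⟨q, hq⟩ := exists_consSucc B w hwB ⟨v, hv, hwv⟩
  have hqv : q.2 ≤ v.2 := by
    by_contra! h; exact hq.2.2.2 v hv hwv h
  have hfq : xprod a v q ≤ xprod a v w := by
    rcases hqv.lt_or_eq with h | h
    · exact hwm q ⟨hq.2.1, haw.trans hq.2.2.1, h⟩
    · rw [C.hy q (G.memB hq.2.1) v (G.memB hv) h, xprod_self_right]; exact hw0'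
  have hfp : xprod a v p ≤ xprod a v w := by
    rcases lt_trichotomy p.2 a.2 with h | h | h
    · have h1 := G.hB p w hp a hab.1 h haw
      have hI := xprod_interp a v p w a
      rw [xprod_self_left] at hI
      have h2 : (w.2 - a.2) * xprod a v p < 0 := by
        nlinarith [mul_pos (sub_pos.2 hav) h1, mul_pos (sub_pos.2 h) hpos]
      have h3 : xprod a v p < 0 := by
        by_contra! h4
        nlinarith [mul_nonneg (sub_nonneg.2 haw.le) h4]
      linarith
    · rw [C.hy p (G.memB hp.1) a (G.memA hab.1) h, xprod_self_left]; exact hw0'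
    · exact hwm p ⟨hp.1, h, hp.2.2.1.trans hwv⟩
  have hr := reflex_of_max C (G.memB hp.1) (G.memB hwB) (G.memB hq.2.1) hav hp.2.2.1 hq.2.2.1
    hfp hfq
  have h1 := hmax p w q ⟨hp, hq, hr⟩ haw (hwv.trans hvb)
  have h2 := G.hA a b hab v hv hav hvb
  have hI := xprod_interp a b a v w
  rw [xprod_self_left] at hI
  nlinarith [mul_pos (sub_pos.2 hab.2.2.1) hpos, mul_pos (sub_pos.2 hwv) (neg_pos.2 h2),
    mul_nonneg (sub_nonneg.2 hav.le) (sub_nonneg.2 h1)]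

theorem step_up {S A B : Finset Pt} {ps pt : Pt} (C : Cfg S ps pt) (G : Good S ps pt A B)
    {a b v : Pt} (hab : Cons A a b) (hv : v ∈ B) (hav : a.2 < v.2) (hvb : v.2 < b.2)
    (hmax : ∀ p w q, Reflex B p w q → a.2 < w.2 → w.2 < b.2 → xprod a b w ≤ xprod a b v) :
    ∀ w ∈ B, v.2 < w.2 → w.2 < b.2 → xprod v b w < 0 := by
  by_contra! hcon
  obtain ⟨w0, hw0, hw01, hw02, hw03⟩ := hcon
  obtain ⟨w, hw, hwm⟩ := Finset.exists_max_image (B.filter (fun c => v.2 < c.2 ∧ c.2 < b.2))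
    (fun c => xprod v b c) ⟨w0, by simp [hw0, hw01, hw02]⟩
  simp only [Finset.mem_filter] at hw hwm
  obtain ⟨hwB, hvw, hwb⟩ := hw
  have hw0' : 0 ≤ xprod v b w := hw03.trans (hwm w0 ⟨hw0, hw01, hw02⟩)
  have hpos : 0 < xprod v b w := by
    refine lt_of_le_of_ne hw0' (Ne.symm ?_)
    apply C.hgp v (G.memB hv) b (G.memA hab.2.1) w (G.memB hwB)
    · rintro rfl; linarith
    · rintro rfl; linarith
    · rintro rfl; linarith
  have hpt : b.2 ≤ pt.2 := C.le_high (G.memA hab.2.1)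
  obtain ⟨q, hq⟩ := exists_consSucc B w hwB ⟨pt, G.tB, by linarith⟩
  obtain ⟨p, hp⟩ := exists_consPred B w hwB ⟨v, hv, hvw⟩
  have hpv : v.2 ≤ p.2 := by
    by_contra! h; exact hp.2.2.2 v hv h hvw
  have hfp : xprod v b p ≤ xprod v b w := by
    rcases hpv.lt_or_eq with h | h
    · exact hwm p ⟨hp.1, h, hp.2.2.1.trans hwb⟩
    · rw [← C.hy v (G.memB hv) p (G.memB hp.1) h, xprod_self_left]; exact hw0'
  have hfq : xprod v b q ≤ xprod v b w := by
    rcases lt_trichotomy b.2 q.2 with h | h | h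
    · have h1 := G.hB w q hq b hab.2.1 hwb h
      have hI := xprod_interp v b w q b
      rw [xprod_self_right] at hI
      have h2 : (b.2 - w.2) * xprod v b q < 0 := by
        nlinarith [mul_pos (sub_pos.2 hvb) h1, mul_pos (sub_pos.2 h) hpos]
      have h3 : xprod v b q < 0 := by
        by_contra! h4
        nlinarith [mul_nonneg (sub_nonneg.2 hwb.le) h4]
      linarith
    · rw [← C.hy b (G.memA hab.2.1) q (G.memB hq.2.1) h, xprod_self_right]; exact hw0'
    · exact hwm q ⟨hq.2.1, hvw.trans hq.2.2.1, h⟩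
  have hr := reflex_of_max C (G.memB hp.1) (G.memB hwB) (G.memB hq.2.1) hvb hp.2.2.1 hq.2.2.1
    hfp hfq
  have h1 := hmax p w q ⟨hp, hq, hr⟩ (hav.trans hvw) hwb
  have h2 := G.hA a b hab v hv hav hvb
  have hI := xprod_interp a b v b w
  rw [xprod_self_right] at hI
  nlinarith [mul_pos (sub_pos.2 hab.2.2.1) hpos, mul_pos (sub_pos.2 hvw) (neg_pos.2 h2),
    mul_nonneg (sub_nonneg.2 hvb.le) (sub_nonneg.2 h1)]

theorem step {S A B : Finset Pt} {ps pt : Pt} (C : Cfg S ps pt) (G : Good S ps pt A B)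
    (hr : ∃ p v q, Reflex B p v q) :
    ∃ v, v ∉ A ∧ Good S ps pt (insert v A) (B.erase v) := by
  obtain ⟨p0, v0, q0, hr0⟩ := hr
  -- middle vertices are not in A
  have key : ∀ p v q, Reflex B p v q → v ∉ A ∧ v ≠ ps ∧ v ≠ pt := by
    intro p v q h
    have h1 : v ≠ ps := by
      rintro rfl
      have := C.le_low (G.memB h.1.1)
      have := h.1.2.2.1
      linarith
    have h2 : v ≠ pt := by
      rintro rfl
      have := C.le_high (G.memB h.2.1.2.1)
      have := h.2.1.2.2.1
      linarith
    refine ⟨fun hA => ?_, h1, h2⟩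
    rcases G.shared v hA h.1.2.1 with h3 | h3
    · exact h1 h3
    · exact h2 h3
  obtain ⟨hv0A, hv0s, hv0t⟩ := key _ _ _ hr0
  have hv0S := G.memB hr0.1.2.1
  obtain ⟨a, haA, hav0, hamax⟩ := exists_low A v0.2 ⟨ps, G.sA, C.hs.2 v0 hv0S hv0s⟩
  obtain ⟨b, hbA, hbv0, hbmin⟩ := exists_up A v0.2 ⟨pt, G.tA, C.ht.2 v0 hv0S hv0t⟩
  have hab : Cons A a b := by
    refine ⟨haA, hbA, hav0.trans hbv0, fun c hc h1 h2 => ?_⟩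
    rcases lt_trichotomy c.2 v0.2 with h | h | h
    · exact absurd (hamax c hc h) (not_le.2 h1)
    · exact hv0A (C.hy c (G.memA hc) v0 hv0S h ▸ hc)
    · exact absurd (hbmin c hc h) (not_le.2 h2)
  classical
  obtain ⟨v, hv, hvm⟩ := Finset.exists_max_image
    (B.filter (fun c => a.2 < c.2 ∧ c.2 < b.2 ∧ ∃ p q, Reflex B p c q))
    (fun c => xprod a b c)
    ⟨v0, by simp only [Finset.mem_filter]; exact ⟨hr0.1.2.1, hav0, hbv0, p0, q0, hr0⟩⟩
  simp only [Finset.mem_filter] at hv hvm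
  obtain ⟨hvB, hav, hvb, p, q, hR⟩ := hv
  have hmax : ∀ p w q, Reflex B p w q → a.2 < w.2 → w.2 < b.2 → xprod a b w ≤ xprod a b v :=
    fun p w q h h1 h2 => hvm w ⟨h.1.2.1, h1, h2, p, q, h⟩
  have hlow := step_low C G hab hvB hav hvb hmax
  have hup := step_up C G hab hvB hav hvb hmax
  obtain ⟨hvA, hvs, hvt⟩ := key _ _ _ hR
  obtain ⟨hpv, hvq, hpos⟩ := hR
  have hvS := G.memB hvB
  refine ⟨v, hvA, ?_, by simp [G.sA], by simp [G.sB, hvs.symm], by simp [G.tA],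
    by simp [G.tB, hvt.symm], ?_, ?_, ?_⟩
  · intro x
    rw [G.cover x]
    by_cases hx : x = v
    · subst hx; simp [hvB]
    · simp [hx]
  · intro x hx hx'
    simp only [Finset.mem_insert, Finset.mem_erase] at hx hx'
    rcases hx with h | h
    · exact absurd h hx'.1
    · exact G.shared x h hx'.2
  · rintro c d ⟨hc, hd, hcd, hbet⟩ w hw hcw hwd
    simp only [Finset.mem_insert, Finset.mem_erase] at hc hd hw hbet
    rcases hc with rfl | hc
    · rcases hd with rfl | hd
      · linarith
      · have hdb : d = b := by
          apply C.hy d (G.memA hd) b (G.memA hbA)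
          apply le_antisymm
          · by_contra! h; exact hbet b (Or.inr hbA) hvb h
          · by_contra! h; exact hab.2.2.2 d hd (hav.trans hcd) h
        subst hdb
        exact hup w hw.2 hcw hwd
    · rcases hd with rfl | hd
      · have hca : c = a := by
          apply C.hy c (G.memA hc) a (G.memA haA)
          apply le_antisymm
          · by_contra! h; exact hab.2.2.2 c hc h (hcd.trans hvb)
          · by_contra! h; exact hbet a (Or.inr haA) h hav
        subst hca
        exact hlow w hw.2 hcw hwd
      · exact G.hA c d ⟨hc, hd, hcd, fun x hx => hbet x (Or.inr hx)⟩ w hw.2 hcw hwd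
  · rintro c d ⟨hc, hd, hcd, hbet⟩ u hu hcu hud
    simp only [Finset.mem_insert, Finset.mem_erase] at hc hd hu hbet
    by_cases hvin : c.2 < v.2 ∧ v.2 < d.2
    · obtain ⟨hcv, hvd⟩ := hvin
      have hcp : c = p := by
        apply C.hy c (G.memB hc.2) p (G.memB hpv.1)
        apply le_antisymm
        · by_contra! h; exact hpv.2.2.2 c hc.2 h hcv
        · by_contra! h
          exact hbet p ⟨by rintro rfl; exact lt_irrefl _ hpv.2.2.1, hpv.1⟩ h
            (hpv.2.2.1.trans hvd)
      have hdq : d = q := by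
        apply C.hy d (G.memB hd.2) q (G.memB hvq.2.1)
        apply le_antisymm
        · by_contra! h
          exact hbet q ⟨by rintro rfl; exact lt_irrefl _ hvq.2.2.1, hvq.2.1⟩
            (hcv.trans hvq.2.2.1) h
        · by_contra! h; exact hvq.2.2.2 d hd.2 hvd h
      subst hcp hdq
      rcases hu with rfl | hu
      · exact hpos
      rcases lt_trichotomy u.2 v.2 with h | h | h
      · have h1 := G.hB c v hpv u hu hcu h
        have hI := xprod_interp c d c v u
        rw [xprod_self_left] at hI
        have : 0 < (v.2 - c.2) * xprod c d u := by
          nlinarith [mul_pos (sub_pos.2 hcu) hpos, mul_pos (sub_pos.2 hcd) h1]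
        exact pos_of_mul_pos_right this (sub_nonneg.2 hcv.le)
      · exact absurd (C.hy u (G.memA hu) v hvS h ▸ hu) hvA
      · have h1 := G.hB v d hvq u hu h hud
        have hI := xprod_interp c d v d u
        rw [xprod_self_right] at hI
        have : 0 < (d.2 - v.2) * xprod c d u := by
          nlinarith [mul_pos (sub_pos.2 hud) hpos, mul_pos (sub_pos.2 hcd) h1]
        exact pos_of_mul_pos_right this (sub_nonneg.2 hvd.le)
    · have hcons : Cons B c d := by
        refine ⟨hc.2, hd.2, hcd, fun x hx h1 h2 => ?_⟩
        by_cases hxv : x = v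
        · subst hxv; exact hvin ⟨h1, h2⟩
        · exact hbet x ⟨hxv, hx⟩ h1 h2
      rcases hu with rfl | hu
      · exact absurd ⟨hcu, hud⟩ hvin
      · exact G.hB c d hcons u hu hcu hud

theorem exists_reflex {S A B : Finset Pt} {ps pt : Pt} (C : Cfg S ps pt) (G : Good S ps pt A B)
    {o a l h c0 : Pt} (hoa : o.2 < a.2) (hl : l ∈ B) (hh : h ∈ B) (hc0 : c0 ∈ B)
    (hlc : l.2 < c0.2) (hch : c0.2 < h.2) (hfl : xprod o a l ≤ xprod o a c0)
    (hfh : xprod o a h ≤ xprod o a c0) : ∃ p v q, Reflex B p v q := by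
  obtain ⟨u, hu, hum⟩ := Finset.exists_max_image (B.filter (fun c => l.2 < c.2 ∧ c.2 < h.2))
    (fun c => xprod o a c) ⟨c0, by simp [hc0, hlc, hch]⟩
  simp only [Finset.mem_filter] at hu hum
  obtain ⟨huB, hlu, huh⟩ := hu
  have h0 := hum c0 ⟨hc0, hlc, hch⟩
  have hall : ∀ c ∈ B, l.2 ≤ c.2 → c.2 ≤ h.2 → xprod o a c ≤ xprod o a u := by
    intro c hc h1 h2
    rcases h1.eq_or_lt with h1 | h1
    · rw [← C.hy l (G.memB hl) c (G.memB hc) h1]; linarith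
    rcases h2.eq_or_lt with h2 | h2
    · rw [C.hy c (G.memB hc) h (G.memB hh) h2]; linarith
    exact hum c ⟨hc, h1, h2⟩
  obtain ⟨p, hp⟩ := exists_consPred B u huB ⟨l, hl, hlu⟩
  obtain ⟨q, hq⟩ := exists_consSucc B u huB ⟨h, hh, huh⟩
  have hlp : l.2 ≤ p.2 := by
    by_contra! h1; exact hp.2.2.2 l hl h1 hlu
  have hqh : q.2 ≤ h.2 := by
    by_contra! h1; exact hq.2.2.2 h hh huh h1
  exact ⟨p, u, q, hp, hq, reflex_of_max C (G.memB hp.1) (G.memB huB) (G.memB hq.2.1) hoa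
    hp.2.2.1 hq.2.2.1 (hall p hp.1 hlp (hp.2.2.1.le.trans huh.le))
    (hall q hq.2.1 (hlu.le.trans hq.2.2.1.le) hqh)⟩

theorem halfplane {S A B : Finset Pt} {ps pt : Pt} (C : Cfg S ps pt) (G : Good S ps pt A B)
    (hno : ¬ ∃ p v q, Reflex B p v q) {p v : Pt} (hpv : Cons B p v) :
    ∀ w ∈ S, 0 ≤ xprod p v w := by
  have hB : ∀ w ∈ B, 0 ≤ xprod p v w := by
    intro w hw
    by_contra! hneg
    rcases lt_trichotomy w.2 p.2 with h | h | h
    · exact hno (exists_reflex C G hpv.2.2.1 hw hpv.2.1 hpv.1 h hpv.2.2.1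
        (by rw [xprod_self_left]; exact hneg.le) (by rw [xprod_self_left, xprod_self_right]))
    · rw [C.hy w (G.memB hw) p (G.memB hpv.1) h, xprod_self_left] at hneg
      exact lt_irrefl _ hneg
    rcases lt_trichotomy w.2 v.2 with h' | h' | h'
    · exact hpv.2.2.2 w hw h h'
    · rw [C.hy w (G.memB hw) v (G.memB hpv.2.1) h', xprod_self_right] at hneg
      exact lt_irrefl _ hneg
    · exact hno (exists_reflex C G hpv.2.2.1 hpv.1 hw hpv.2.1 hpv.2.2.1 h'
        (by rw [xprod_self_left, xprod_self_right]) (by rw [xprod_self_right]; exact hneg.le))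
  intro w hw
  by_cases hwB : w ∈ B
  · exact hB w hwB
  have hwA : w ∈ A := ((G.cover w).1 hw).resolve_right hwB
  have hws : w ≠ ps := by rintro rfl; exact hwB G.sB
  have hwt : w ≠ pt := by rintro rfl; exact hwB G.tB
  obtain ⟨c, hc, hcw, hcm⟩ := exists_low B w.2 ⟨ps, G.sB, C.hs.2 w hw hws⟩
  obtain ⟨d, hd, hwd, hdm⟩ := exists_up B w.2 ⟨pt, G.tB, C.ht.2 w hw hwt⟩
  have hcd : Cons B c d := by
    refine ⟨hc, hd, hcw.trans hwd, fun x hx h1 h2 => ?_⟩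
    rcases lt_trichotomy x.2 w.2 with h | h | h
    · exact absurd (hcm x hx h) (not_le.2 h1)
    · exact hwB (C.hy x (G.memB hx) w hw h ▸ hx)
    · exact absurd (hdm x hx h) (not_le.2 h2)
  have h1 := G.hB c d hcd w hwA hcw hwd
  have hI := xprod_interp p v c d w
  have h2 : 0 ≤ (d.2 - c.2) * xprod p v w := by
    nlinarith [mul_nonneg (sub_nonneg.2 hwd.le) (hB c hc), mul_nonneg (sub_nonneg.2 hcw.le) (hB d hd),
      mul_pos (sub_pos.2 hpv.2.2.1) h1]
  exact nonneg_of_mul_nonneg_right h2 (by linarith)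

theorem mem_frontier_of_halfplane {S : Finset Pt} {p v z : Pt} (hpv : p.2 < v.2) (hz : z ∈ S)
    (hS : ∀ w ∈ S, 0 ≤ xprod p v w) (h0 : xprod p v z = 0) :
    z ∈ frontier (convexHull ℝ (S : Set Pt)) := by
  have hsub : convexHull ℝ (S : Set Pt) ⊆ {x | 0 ≤ xprod p v x} := by
    apply convexHull_min
    · intro w hw; exact hS w hw
    · intro x hx y hy s t hs ht hst
      simp only [Set.mem_ofPred_eq] at hx hy ⊢
      have : xprod p v (s • x + t • y) = s * xprod p v x + t * xprod p v y := by
        have ht' : t = 1 - s := by linarith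
        subst ht'
        simp only [xprod, Prod.fst_add, Prod.snd_add, Prod.smul_fst, Prod.smul_snd, smul_eq_mul]
        ring
      rw [this]; positivity
  refine ⟨subset_closure (subset_convexHull ℝ _ hz), fun hint => ?_⟩
  have hnh : {x : Pt | 0 ≤ xprod p v x} ∈ nhds z :=
    Filter.mem_of_superset (mem_interior_iff_mem_nhds.1 hint) hsub
  have hcont : Filter.Tendsto (fun t : ℝ => ((z.1 + t, z.2) : Pt)) (nhds 0) (nhds z) := by
    have : Continuous (fun t : ℝ => ((z.1 + t, z.2) : Pt)) := by fun_prop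
    have h := this.tendsto 0
    simpa using h
  have hev := hcont hnh
  rw [Filter.mem_map, Metric.mem_nhds_iff] at hev
  obtain ⟨ε, hε, hball⟩ := hev
  have hmem : (ε / 2) ∈ Metric.ball (0 : ℝ) ε := by
    rw [Metric.mem_ball, Real.dist_eq, sub_zero, abs_of_pos (by linarith)]; linarith
  have h1 := hball hmem
  simp only [Set.mem_preimage, Set.mem_ofPred_eq] at h1
  have h2 : xprod p v (z.1 + ε / 2, z.2) = xprod p v z - (v.2 - p.2) * (ε / 2) := by
    simp only [xprod]; ring
  rw [h2, h0] at h1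
  have := mul_pos (sub_pos.2 hpv) (half_pos hε)
  linarith

theorem envR_sub (S : Finset Pt) (ps pt : Pt) : rightEnvelope S ps pt ⊆ (S : Set Pt) :=
  fun _ h => h.1.1

theorem card_le_of_noReflex {S A B : Finset Pt} {ps pt : Pt} (C : Cfg S ps pt)
    (G : Good S ps pt A B) (hst : ps ≠ pt)
    (hno : ¬ ∃ p v q, Reflex B p v q) : B.card ≤ (rightEnvelope S ps pt).ncard := by
  rw [← Set.ncard_coe_finset B]
  apply Set.ncard_le_ncard _ (S.finite_toSet.subset (envR_sub S ps pt))
  intro v hv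
  have hv : v ∈ B := hv
  have hlt : ps.2 < pt.2 := C.hs.2 pt C.ht.1 hst.symm
  refine ⟨⟨G.memB hv, ?_⟩, ?_⟩
  · by_cases hvs : v = ps
    · obtain ⟨q, hq⟩ := exists_consSucc B v hv ⟨pt, G.tB, hvs ▸ hlt⟩
      exact mem_frontier_of_halfplane hq.2.2.1 (G.memB hv) (halfplane C G hno hq)
        (xprod_self_left _ _)
    · obtain ⟨p, hp⟩ := exists_consPred B v hv ⟨ps, G.sB, C.hs.2 v (G.memB hv) hvs⟩
      exact mem_frontier_of_halfplane hp.2.2.1 (G.memB hv) (halfplane C G hno hp)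
        (xprod_self_right _ _)
  · by_contra! hpos
    have hvs : v ≠ ps := by rintro rfl; rw [xprod_self_left] at hpos; exact lt_irrefl _ hpos
    have hvt : v ≠ pt := by rintro rfl; rw [xprod_self_right] at hpos; exact lt_irrefl _ hpos
    exact hno (exists_reflex C G hlt G.sB G.tB hv (C.hs.2 v (G.memB hv) hvs)
      (C.ht.2 v (G.memB hv) hvt) (by rw [xprod_self_left]; exact hpos.le)
      (by rw [xprod_self_right]; exact hpos.le))

theorem base {S : Finset Pt} {ps pt : Pt} (C : Cfg S ps pt) (hst : ps ≠ pt) :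
    ∃ A B, Good S ps pt A B := by
  have hlt : ps.2 < pt.2 := C.hs.2 pt C.ht.1 hst.symm
  have hne : ∀ v ∈ S, v ≠ ps → v ≠ pt → xprod ps pt v ≠ 0 := fun v hv h1 h2 =>
    C.hgp ps C.hs.1 pt C.ht.1 v hv hst h1.symm h2.symm
  have hb : ∀ a ∈ S, ∀ b ∈ S, ∀ v ∈ S, a.2 < v.2 → v.2 < b.2 → v ≠ ps ∧ v ≠ pt := by
    intro a ha b hb v hv h1 h2
    constructor
    · rintro rfl; exact absurd (C.le_low ha) (not_le.2 h1)
    · rintro rfl; exact absurd (C.le_high hb) (not_le.2 h2)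
  refine ⟨S.filter (fun v => 0 ≤ xprod ps pt v), S.filter (fun v => xprod ps pt v ≤ 0),
    ?_, ?_, ?_, ?_, ?_, ?_, ?_, ?_⟩
  · intro p
    simp only [Finset.mem_filter]
    constructor
    · intro h
      rcases le_total 0 (xprod ps pt p) with h1 | h1
      · exact Or.inl ⟨h, h1⟩
      · exact Or.inr ⟨h, h1⟩
    · rintro (h | h) <;> exact h.1
  · simp [C.hs.1, xprod_self_left]
  · simp [C.hs.1, xprod_self_left]
  · simp [C.ht.1, xprod_self_right]
  · simp [C.ht.1, xprod_self_right]
  · intro p h1 h2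
    simp only [Finset.mem_filter] at h1 h2
    by_contra! h
    exact hne p h1.1 h.1 h.2 (le_antisymm h2.2 h1.2)
  · rintro a b ⟨ha, hb', hab, -⟩ v hv h1 h2
    simp only [Finset.mem_filter] at ha hb' hv
    obtain ⟨h3, h4⟩ := hb a ha.1 b hb'.1 v hv.1 h1 h2
    have h5 : xprod ps pt v < 0 := lt_of_le_of_ne hv.2 (hne v hv.1 h3 h4)
    have hI := xprod_interp ps pt a b v
    have h6 : (pt.2 - ps.2) * xprod a b v < 0 := by
      nlinarith [mul_nonneg (sub_nonneg.2 h2.le) ha.2, mul_nonneg (sub_nonneg.2 h1.le) hb'.2,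
        mul_pos (sub_pos.2 hab) (neg_pos.2 h5)]
    by_contra! h7
    nlinarith [mul_nonneg (sub_nonneg.2 hlt.le) h7]
  · rintro a b ⟨ha, hb', hab, -⟩ v hv h1 h2
    simp only [Finset.mem_filter] at ha hb' hv
    obtain ⟨h3, h4⟩ := hb a ha.1 b hb'.1 v hv.1 h1 h2
    have h5 : 0 < xprod ps pt v := lt_of_le_of_ne hv.2 (hne v hv.1 h3 h4).symm
    have hI := xprod_interp ps pt a b v
    have h6 : 0 < (pt.2 - ps.2) * xprod a b v := by
      nlinarith [mul_nonneg (sub_nonneg.2 h2.le) (neg_nonneg.2 ha.2),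
        mul_nonneg (sub_nonneg.2 h1.le) (neg_nonneg.2 hb'.2), mul_pos (sub_pos.2 hab) h5]
    exact pos_of_mul_pos_right h6 (sub_nonneg.2 hlt.le)

/-- Reflection in the vertical axis. -/
def mir : Pt ≃L[ℝ] Pt := (ContinuousLinearEquiv.neg ℝ).prodCongr (ContinuousLinearEquiv.refl ℝ ℝ)

theorem mir_apply (p : Pt) : mir p = (-p.1, p.2) := rfl
theorem mir_mir (p : Pt) : mir (mir p) = p := by simp [mir_apply]
theorem mir_snd (p : Pt) : (mir p).2 = p.2 := rfl
theorem xprod_mir (o a b : Pt) : xprod (mir o) (mir a) (mir b) = - xprod o a b := by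
  simp only [xprod, mir_apply]; ring

theorem mem_mir (S : Finset Pt) (p : Pt) : p ∈ S.image mir ↔ mir p ∈ S := by
  simp only [Finset.mem_image]
  constructor
  · rintro ⟨q, hq, rfl⟩; rwa [mir_mir]
  · intro h; exact ⟨mir p, h, mir_mir p⟩

theorem mir_inj : Function.Injective mir := mir.injective

theorem Cfg.mir {S : Finset Pt} {ps pt : Pt} (C : Cfg S ps pt) :
    Cfg (S.image mir) (mir ps) (mir pt) := by
  refine ⟨?_, ?_, ⟨?_, ?_⟩, ⟨?_, ?_⟩⟩
  · intro p hp q hq h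
    rw [mem_mir] at hp hq
    exact mir_inj (C.hy _ hp _ hq h)
  · intro p hp q hq r hr h1 h2 h3 h0
    rw [mem_mir] at hp hq hr
    refine C.hgp _ hp _ hq _ hr (mir_inj.ne h1) (mir_inj.ne h2) (mir_inj.ne h3) ?_
    rw [xprod_mir, h0, neg_zero]
  · rw [mem_mir, mir_mir]; exact C.hs.1
  · intro q hq hne
    rw [mem_mir] at hq
    exact C.hs.2 (_root_.mir q) hq (fun h => hne (by rw [← h, mir_mir]))
  · rw [mem_mir, mir_mir]; exact C.ht.1
  · intro q hq hne
    rw [mem_mir] at hq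
    exact C.ht.2 (_root_.mir q) hq (fun h => hne (by rw [← h, mir_mir]))

theorem Cons.mir {A : Finset Pt} {a b : Pt} (h : Cons (A.image mir) a b) :
    Cons A (mir a) (mir b) := by
  obtain ⟨h1, h2, h3, h4⟩ := h
  rw [mem_mir] at h1 h2
  refine ⟨h1, h2, h3, fun c hc => ?_⟩
  have := h4 (_root_.mir c) (by rw [mem_mir, mir_mir]; exact hc)
  exact this

theorem Good.mir {S A B : Finset Pt} {ps pt : Pt} (G : Good S ps pt A B) :
    Good (S.image mir) (mir ps) (mir pt) (B.image mir) (A.image mir) := by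
  refine ⟨?_, ?_, ?_, ?_, ?_, ?_, ?_, ?_⟩
  · intro p
    rw [mem_mir, mem_mir, mem_mir, G.cover]; exact or_comm
  · rw [mem_mir, mir_mir]; exact G.sB
  · rw [mem_mir, mir_mir]; exact G.sA
  · rw [mem_mir, mir_mir]; exact G.tB
  · rw [mem_mir, mir_mir]; exact G.tA
  · intro p h1 h2
    rw [mem_mir] at h1 h2
    rcases G.shared _ h2 h1 with h | h
    · left; rw [← h, mir_mir]
    · right; rw [← h, mir_mir]
  · intro a b hab v hv h1 h2
    rw [mem_mir] at hv
    have := G.hB _ _ hab.mir _ hv h1 h2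
    rw [xprod_mir] at this; linarith
  · intro a b hab v hv h1 h2
    rw [mem_mir] at hv
    have := G.hA _ _ hab.mir _ hv h1 h2
    rw [xprod_mir] at this; linarith

theorem image_mir_mir (S : Finset Pt) : (S.image mir).image mir = S := by
  ext p; rw [mem_mir, mem_mir, mir_mir]

theorem env_mir (S : Finset Pt) (ps pt : Pt) :
    (rightEnvelope (S.image mir) (mir ps) (mir pt)).ncard ≤ (leftEnvelope S ps pt).ncard := by
  have hfin : (leftEnvelope S ps pt).Finite := S.finite_toSet.subset (fun _ h => h.1.1)
  refine le_trans (Set.ncard_le_ncard ?_ (hfin.image mir)) (Set.ncard_image_le hfin)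
  rintro p ⟨⟨h1, h2⟩, h3⟩
  refine ⟨mir p, ⟨⟨(mem_mir S p).1 h1, ?_⟩, ?_⟩, mir_mir p⟩
  · rw [Finset.coe_image] at h2
    have h4 : convexHull ℝ (mir '' (S : Set Pt)) = mir '' (convexHull ℝ (S : Set Pt)) :=
      (mir.toLinearEquiv.toLinearMap.image_convexHull (S : Set Pt)).symm
    rw [h4] at h2
    have h5 : frontier (mir '' (convexHull ℝ (S : Set Pt)))
        = mir '' frontier (convexHull ℝ (S : Set Pt)) :=
      (mir.toHomeomorph.image_frontier _).symm
    rw [h5] at h2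
    obtain ⟨q, hq, rfl⟩ := h2
    rw [mir_mir]; exact hq
  · have := xprod_mir ps pt (mir p)
    rw [mir_mir] at this
    linarith

theorem stepUp {S A B : Finset Pt} {ps pt : Pt} (C : Cfg S ps pt) (hst : ps ≠ pt)
    (G : Good S ps pt A B) (h : (rightEnvelope S ps pt).ncard < B.card) :
    ∃ A' B', Good S ps pt A' B' ∧ A'.card = A.card + 1 := by
  have hr : ∃ p v q, Reflex B p v q := by
    by_contra hno
    exact absurd (card_le_of_noReflex C G hst hno) (not_le.2 h)
  obtain ⟨v, hv, G'⟩ := step C G hr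
  exact ⟨_, _, G', Finset.card_insert_of_notMem hv⟩

theorem card_add {S A B : Finset Pt} {ps pt : Pt} (hst : ps ≠ pt) (G : Good S ps pt A B) :
    A.card + B.card = S.card + 2 := by
  have h1 : A ∪ B = S := by ext p; rw [Finset.mem_union, ← G.cover]
  have h2 : A ∩ B = {ps, pt} := by
    ext p
    simp only [Finset.mem_inter, Finset.mem_insert, Finset.mem_singleton]
    constructor
    · rintro ⟨h, h'⟩; exact G.shared p h h'
    · rintro (rfl | rfl)
      · exact ⟨G.sA, G.sB⟩
      · exact ⟨G.tA, G.tB⟩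
  rw [← Finset.card_union_add_card_inter, h1, h2, Finset.card_pair hst]

theorem stepDown {S A B : Finset Pt} {ps pt : Pt} (C : Cfg S ps pt) (hst : ps ≠ pt)
    (G : Good S ps pt A B) (h : (leftEnvelope S ps pt).ncard < A.card) :
    ∃ A' B', Good S ps pt A' B' ∧ A'.card + 1 = A.card := by
  obtain ⟨A', B', G', hc⟩ := stepUp C.mir (mir_inj.ne hst) G.mir (by
    rw [Finset.card_image_of_injective _ mir_inj]
    exact (env_mir S ps pt).trans_lt h)
  have G2 := G'.mir
  rw [image_mir_mir, mir_mir, mir_mir] at G2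
  refine ⟨_, _, G2, ?_⟩
  have h1 := card_add hst G
  have h2 := card_add (mir_inj.ne hst) G'
  rw [Finset.card_image_of_injective _ mir_inj] at *
  omega

theorem reach {S : Finset Pt} {ps pt : Pt} (C : Cfg S ps pt) (hst : ps ≠ pt) (m : ℕ)
    (hm1 : (leftEnvelope S ps pt).ncard ≤ m)
    (hm2 : m ≤ S.card - (rightEnvelope S ps pt).ncard + 2) :
    ∃ A B, Good S ps pt A B ∧ A.card = m := by
  have hER : (rightEnvelope S ps pt).ncard ≤ S.card := by
    rw [← Set.ncard_coe_finset S]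
    exact Set.ncard_le_ncard (envR_sub S ps pt) S.finite_toSet
  obtain ⟨A0, B0, G0⟩ := base C hst
  have up : ∀ j, A0.card + j ≤ m → ∃ A B, Good S ps pt A B ∧ A.card = A0.card + j := by
    intro j
    induction j with
    | zero => intro _; exact ⟨A0, B0, G0, rfl⟩
    | succ j ih =>
      intro hj
      obtain ⟨A, B, G, hA⟩ := ih (by omega)
      have := card_add hst G
      obtain ⟨A', B', G', hA'⟩ := stepUp C hst G (by omega)
      exact ⟨A', B', G', by omega⟩
  have down : ∀ j, m + j ≤ A0.card → ∃ A B, Good S ps pt A B ∧ A.card + j = A0.card := by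
    intro j
    induction j with
    | zero => intro _; exact ⟨A0, B0, G0, rfl⟩
    | succ j ih =>
      intro hj
      obtain ⟨A, B, G, hA⟩ := ih (by omega)
      obtain ⟨A', B', G', hA'⟩ := stepDown C hst G (by omega)
      exact ⟨A', B', G', by omega⟩
  rcases le_total A0.card m with h | h
  · obtain ⟨A, B, G, hA⟩ := up (m - A0.card) (by omega)
    exact ⟨A, B, G, by omega⟩
  · obtain ⟨A, B, G, hA⟩ := down (A0.card - m) (by omega)
    exact ⟨A, B, G, by omega⟩

theorem exists_sorted (A : Finset Pt) (hinj : ∀ p ∈ A, ∀ q ∈ A, p.2 = q.2 → p = q) :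
    ∃ l : List Pt, (∀ p, p ∈ l ↔ p ∈ A) ∧ l.Pairwise (fun p q => p.2 < q.2) := by
  classical
  induction A using Finset.induction_on_min_value (fun p : Pt => p.2) with
  | empty => exact ⟨[], by simp, List.Pairwise.nil⟩
  | insert a s has hmin ih =>
    obtain ⟨l, hl, hp⟩ := ih (fun p hp q hq h => hinj p (Finset.mem_insert_of_mem hp) q
      (Finset.mem_insert_of_mem hq) h)
    refine ⟨a :: l, by simp [hl], List.Pairwise.cons (fun b hb => ?_) hp⟩
    have hbs := (hl b).1 hb
    refine lt_of_le_of_ne (hmin b hbs) (fun h => has ?_)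
    rw [hinj a (Finset.mem_insert_self _ _) b (Finset.mem_insert_of_mem hbs) h]
    exact hbs

theorem edges_cons (l : List Pt) (hl : l.Pairwise (fun p q => p.2 < q.2)) :
    ∀ e ∈ edgesOf l, e.1 ∈ l ∧ e.2 ∈ l ∧ e.1.2 < e.2.2 ∧
      ∀ c ∈ l, e.1.2 < c.2 → c.2 < e.2.2 → False := by
  induction l with
  | nil => simp [edgesOf]
  | cons x t ih =>
    cases t with
    | nil => simp [edgesOf]
    | cons y t =>
      have hx := (List.pairwise_cons.1 hl).1
      have hyt := (List.pairwise_cons.1 hl).2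
      intro e he
      have he' : e = (x, y) ∨ e ∈ edgesOf (y :: t) := by
        simpa [edgesOf] using he
      rcases he' with rfl | he'
      · refine ⟨by simp, by simp, hx y (by simp), fun c hc h1 h2 => ?_⟩
        simp only [List.mem_cons] at hc
        rcases hc with rfl | rfl | hc
        · exact lt_irrefl _ h1
        · exact lt_irrefl _ h2
        · exact absurd ((List.pairwise_cons.1 hyt).1 c hc) (not_lt.2 h2.le)
      · obtain ⟨h1, h2, h3, h4⟩ := ih hyt e he'
        refine ⟨List.mem_cons_of_mem _ h1, List.mem_cons_of_mem _ h2, h3, fun c hc h5 h6 => ?_⟩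
        rcases List.mem_cons.1 hc with rfl | hc
        · exact absurd (hx _ h1) (not_lt.2 h5.le)
        · exact h4 c hc h5 h6

theorem seg_coords {a b x : Pt} (hx : x ∈ Seg a b) (hab : a.2 < b.2) :
    a.2 ≤ x.2 ∧ x.2 ≤ b.2 ∧ xprod a b x = 0 := by
  obtain ⟨s, t, hs, ht, hst, rfl⟩ := hx
  have hs' : s = 1 - t := by linarith
  subst hs'
  simp only [xprod, Prod.fst_add, Prod.snd_add, Prod.smul_fst, Prod.smul_snd, smul_eq_mul]
  refine ⟨by nlinarith, by nlinarith, by ring⟩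

theorem eq_of_height_left {a b x : Pt} (hx : x ∈ Seg a b) (hab : a.2 < b.2) (h : x.2 = a.2) :
    x = a := by
  obtain ⟨h1, h2, h3⟩ := seg_coords hx hab
  refine Prod.ext ?_ h
  unfold xprod at h3
  rw [h] at h3
  have : (b.2 - a.2) * (x.1 - a.1) = 0 := by linarith
  rcases mul_eq_zero.1 this with h4 | h4 <;> linarith

theorem eq_of_height_right {a b x : Pt} (hx : x ∈ Seg a b) (hab : a.2 < b.2) (h : x.2 = b.2) :
    x = b := by
  obtain ⟨h1, h2, h3⟩ := seg_coords hx hab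
  refine Prod.ext ?_ h
  unfold xprod at h3
  rw [h] at h3
  have : (b.2 - a.2) * (x.1 - b.1) = 0 := by linarith
  rcases mul_eq_zero.1 this with h4 | h4 <;> linarith

/-- Scaled horizontal gap between the lines `cd` and `ab` at height `y`. -/
def gapH (a b c d : Pt) (y : ℝ) : ℝ :=
  (b.2 - a.2) * (c.1 * (d.2 - y) + d.1 * (y - c.2)) -
    (d.2 - c.2) * (a.1 * (b.2 - y) + b.1 * (y - a.2))

theorem leftOf_edges {S A B : Finset Pt} {ps pt : Pt} (C : Cfg S ps pt) (G : Good S ps pt A B)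
    (h3 : ∃ w ∈ S, w ≠ ps ∧ w ≠ pt) {a b c d x z : Pt} (hab : Cons A a b) (hcd : Cons B c d)
    (hx : x ∈ Seg a b) (hz : z ∈ Seg c d) (hxz : x.2 = z.2) (hsx : ps.2 < x.2)
    (hxt : x.2 < pt.2) : x.1 < z.1 := by
  obtain ⟨hax, hxb, hx0⟩ := seg_coords hx hab.2.2.1
  obtain ⟨hcz, hzd, hz0⟩ := seg_coords hz hcd.2.2.1
  have hab' := hab.2.2.1
  have hcd' := hcd.2.2.1
  rw [← hxz] at hcz hzd
  have noshare : ∀ u ∈ A, ∀ v ∈ B, u.2 = v.2 → (u = ps ∧ v = ps) ∨ (u = pt ∧ v = pt) := by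
    intro u hu v hv h
    have := C.hy u (G.memA hu) v (G.memB hv) h
    subst this
    rcases G.shared u hu hv with h | h
    · exact Or.inl ⟨h, h⟩
    · exact Or.inr ⟨h, h⟩
  have had : a.2 < d.2 := by
    refine lt_of_le_of_ne (hax.trans hzd) (fun h => ?_)
    rcases noshare a hab.1 d hcd.2.1 h with ⟨h1, h2⟩ | ⟨h1, h2⟩
    · subst h1; subst h2; linarith
    · subst h1; subst h2; linarith
  have hcb : c.2 < b.2 := by
    refine lt_of_le_of_ne (hcz.trans hxb) (fun h => ?_)
    rcases noshare b hab.2.1 c hcd.1 h.symm with ⟨h1, h2⟩ | ⟨h1, h2⟩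
    · subst h1; subst h2; linarith
    · subst h1; subst h2; linarith
  have ea : gapH a b c d a.2 = (b.2 - a.2) * xprod c d a := by unfold gapH xprod; ring
  have eb : gapH a b c d b.2 = (b.2 - a.2) * xprod c d b := by unfold gapH xprod; ring
  have ec : gapH a b c d c.2 = -((d.2 - c.2) * xprod a b c) := by unfold gapH xprod; ring
  have ed : gapH a b c d d.2 = -((d.2 - c.2) * xprod a b d) := by unfold gapH xprod; ring
  have ex : gapH a b c d x.2 = (b.2 - a.2) * (d.2 - c.2) * (z.1 - x.1) := by
    unfold xprod at hx0 hz0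
    rw [← hxz] at hz0
    unfold gapH
    linear_combination (b.2 - a.2) * hz0 - (d.2 - c.2) * hx0
  have hlo : ∃ lo, lo ≤ x.2 ∧ (lo = a.2 ∨ lo = c.2) ∧
      (0 < gapH a b c d lo ∨ (gapH a b c d lo = 0 ∧ a = ps ∧ c = ps ∧ lo = ps.2)) := by
    rcases lt_trichotomy a.2 c.2 with h | h | h
    · refine ⟨c.2, hcz, Or.inr rfl, Or.inl ?_⟩
      have := G.hA a b hab c hcd.1 h hcb
      rw [ec]; nlinarith [mul_pos (sub_pos.2 hcd') (neg_pos.2 this)]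
    · rcases noshare a hab.1 c hcd.1 h with ⟨h1, h2⟩ | ⟨h1, h2⟩
      · refine ⟨a.2, hax, Or.inl rfl, Or.inr ⟨?_, h1, h2, by rw [h1]⟩⟩
        rw [ea, h1, h2, xprod_self_left, mul_zero]
      · subst h1; linarith
    · refine ⟨a.2, hax, Or.inl rfl, Or.inl ?_⟩
      have := G.hB c d hcd a hab.1 h had
      rw [ea]; exact mul_pos (sub_pos.2 hab') this
  have hhi : ∃ hi, x.2 ≤ hi ∧ (hi = b.2 ∨ hi = d.2) ∧
      (0 < gapH a b c d hi ∨ (gapH a b c d hi = 0 ∧ b = pt ∧ d = pt ∧ hi = pt.2)) := by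
    rcases lt_trichotomy d.2 b.2 with h | h | h
    · refine ⟨d.2, hzd, Or.inr rfl, Or.inl ?_⟩
      have := G.hA a b hab d hcd.2.1 had h
      rw [ed]; nlinarith [mul_pos (sub_pos.2 hcd') (neg_pos.2 this)]
    · rcases noshare b hab.2.1 d hcd.2.1 h.symm with ⟨h1, h2⟩ | ⟨h1, h2⟩
      · subst h1; linarith
      · refine ⟨b.2, hxb, Or.inl rfl, Or.inr ⟨?_, h1, h2, by rw [h1]⟩⟩
        rw [eb, h1, h2, xprod_self_right, mul_zero]
    · refine ⟨b.2, hxb, Or.inl rfl, Or.inl ?_⟩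
      have := G.hB c d hcd b hab.2.1 hcb h
      rw [eb]; exact mul_pos (sub_pos.2 hab') this
  obtain ⟨lo, hlo1, -, hlo2⟩ := hlo
  obtain ⟨hi, hhi1, -, hhi2⟩ := hhi
  have hI : (hi - lo) * gapH a b c d x.2
      = (hi - x.2) * gapH a b c d lo + (x.2 - lo) * gapH a b c d hi := by
    unfold gapH; ring
  have hpos : 0 < gapH a b c d x.2 := by
    rcases hlo1.eq_or_lt with h | hlo1
    · rcases hlo2 with h2 | ⟨-, -, -, h2⟩
      · rwa [← h]
      · linarith
    rcases hhi1.eq_or_lt with h | hhi1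
    · rcases hhi2 with h2 | ⟨-, -, -, h2⟩
      · rwa [h]
      · linarith
    have : 0 < (hi - lo) * gapH a b c d x.2 := by
      rw [hI]
      rcases hlo2 with h1 | ⟨h1, e1, e2, -⟩
      · have : 0 ≤ gapH a b c d hi := by
          rcases hhi2 with h2 | ⟨h2, -⟩
          · exact h2.le
          · exact h2.ge
        have := mul_pos (sub_pos.2 hhi1) h1
        have := mul_nonneg (sub_nonneg.2 hlo1.le) ‹0 ≤ gapH a b c d hi›
        linarith
      · rcases hhi2 with h2 | ⟨-, e3, e4, -⟩
        · rw [h1, mul_zero, zero_add]; exact mul_pos (sub_pos.2 hlo1) h2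
        · exfalso
          obtain ⟨w, hw, hws, hwt⟩ := h3
          have h5 := C.hs.2 w hw hws
          have h6 := C.ht.2 w hw hwt
          rcases (G.cover w).1 hw with h | h
          · exact hab.2.2.2 w h (by rw [e1]; exact h5) (by rw [e3]; exact h6)
          · exact hcd.2.2.2 w h (by rw [e2]; exact h5) (by rw [e4]; exact h6)
    exact pos_of_mul_pos_right this (by linarith)
  rw [ex] at hpos
  have h7 : 0 < (b.2 - a.2) * (d.2 - c.2) := mul_pos (sub_pos.2 hab') (sub_pos.2 hcd')
  have := pos_of_mul_pos_right hpos h7.le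
  linarith

theorem head_sorted (l : List Pt) (hl : l.Pairwise (fun p q => p.2 < q.2)) (ps : Pt) (hs : ps ∈ l)
    (hmin : ∀ q ∈ l, ps.2 ≤ q.2) : l.head? = some ps := by
  cases l with
  | nil => simp at hs
  | cons x t =>
    rcases List.mem_cons.1 hs with rfl | h
    · rfl
    · exact absurd ((List.pairwise_cons.1 hl).1 ps h) (not_lt.2 (hmin x (by simp)))

theorem last_sorted (l : List Pt) (hl : l.Pairwise (fun p q => p.2 < q.2)) (pt : Pt) (hs : pt ∈ l)
    (hmax : ∀ q ∈ l, q.2 ≤ pt.2) : l.getLast? = some pt := by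
  rcases List.eq_nil_or_concat' l with rfl | ⟨t, x, rfl⟩
  · simp at hs
  · rw [List.getLast?_concat]
    rw [List.pairwise_append] at hl
    rcases List.mem_append.1 hs with h | h
    · exact absurd (hl.2.2 pt h x (by simp)) (not_lt.2 (hmax x (by simp)))
    · simp at h; rw [h]

theorem nodup_sorted (l : List Pt) (hl : l.Pairwise (fun p q => p.2 < q.2)) : l.Nodup :=
  hl.imp (fun h e => by rw [e] at h; exact lt_irrefl _ h)

theorem segNC_same {A S : Finset Pt} (hy : DistinctY S) (hAS : ∀ p ∈ A, p ∈ S)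
    {e f : Pt × Pt} (he : Cons A e.1 e.2) (hf : Cons A f.1 f.2) (hne : e ≠ f) : SegNC e f := by
  intro x hx hx'
  obtain ⟨h1, h2, -⟩ := seg_coords hx he.2.2.1
  obtain ⟨h3, h4, -⟩ := seg_coords hx' hf.2.2.1
  rcases le_or_gt e.2.2 f.1.2 with h | h
  · exact ⟨Or.inr (eq_of_height_right hx he.2.2.1 (by linarith)),
      Or.inl (eq_of_height_left hx' hf.2.2.1 (by linarith))⟩
  rcases le_or_gt f.2.2 e.1.2 with h' | h'
  · exact ⟨Or.inl (eq_of_height_left hx he.2.2.1 (by linarith)),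
      Or.inr (eq_of_height_right hx' hf.2.2.1 (by linarith))⟩
  exfalso
  apply hne
  apply Prod.ext
  · apply hy _ (hAS _ he.1) _ (hAS _ hf.1)
    apply le_antisymm
    · by_contra! h5; exact hf.2.2.2 _ he.1 h5 h'
    · by_contra! h5; exact he.2.2.2 _ hf.1 h5 h
  · apply hy _ (hAS _ he.2.1) _ (hAS _ hf.2.1)
    apply le_antisymm
    · by_contra! h5; exact he.2.2.2 _ hf.2.1 h' h5
    · by_contra! h5; exact hf.2.2.2 _ he.2.1 h h5

theorem segNC_cross {S A B : Finset Pt} {ps pt : Pt} (C : Cfg S ps pt) (G : Good S ps pt A B)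
    (h3 : ∃ w ∈ S, w ≠ ps ∧ w ≠ pt) {e f : Pt × Pt} (he : Cons A e.1 e.2)
    (hf : Cons B f.1 f.2) : SegNC e f := by
  intro x hx hx'
  obtain ⟨h1, h2, -⟩ := seg_coords hx he.2.2.1
  obtain ⟨h5, h4, -⟩ := seg_coords hx' hf.2.2.1
  have l1 := C.le_low (G.memA he.1)
  have l2 := C.le_low (G.memB hf.1)
  have l3 := C.le_high (G.memA he.2.1)
  have l4 := C.le_high (G.memB hf.2.1)
  rcases le_or_gt x.2 ps.2 with h | h
  · exact ⟨Or.inl (eq_of_height_left hx he.2.2.1 (by linarith)),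
      Or.inl (eq_of_height_left hx' hf.2.2.1 (by linarith))⟩
  rcases le_or_gt pt.2 x.2 with h' | h'
  · exact ⟨Or.inr (eq_of_height_right hx he.2.2.1 (by linarith)),
      Or.inr (eq_of_height_right hx' hf.2.2.1 (by linarith))⟩
  exact absurd (leftOf_edges C G h3 he hf hx hx' rfl h h') (lt_irrefl _)

theorem realize {S A B : Finset Pt} {ps pt : Pt} (C : Cfg S ps pt) (G : Good S ps pt A B)
    (h3 : ∃ w ∈ S, w ≠ ps ∧ w ≠ pt) :
    ∃ L R : List Pt, IsNCMonoHamCycle S ps pt L R ∧ LeftOf L R ps pt ∧ L.length = A.card := by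
  obtain ⟨L, hL, hLp⟩ := exists_sorted A
    (fun p hp q hq h => C.hy p (G.memA hp) q (G.memA hq) h)
  obtain ⟨R, hR, hRp⟩ := exists_sorted B
    (fun p hp q hq h => C.hy p (G.memB hp) q (G.memB hq) h)
  have eL : ∀ e ∈ edgesOf L, Cons A e.1 e.2 := by
    intro e he
    obtain ⟨h1, h2, h4, h5⟩ := edges_cons L hLp e he
    exact ⟨(hL _).1 h1, (hL _).1 h2, h4, fun c hc => h5 c ((hL c).2 hc)⟩
  have eR : ∀ e ∈ edgesOf R, Cons B e.1 e.2 := by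
    intro e he
    obtain ⟨h1, h2, h4, h5⟩ := edges_cons R hRp e he
    exact ⟨(hR _).1 h1, (hR _).1 h2, h4, fun c hc => h5 c ((hR c).2 hc)⟩
  refine ⟨L, R, ⟨?_, ?_, ?_, ?_, ?_, ?_, ?_, ?_, ?_, ?_, ?_⟩, ?_, ?_⟩
  · exact hLp.isChain
  · exact hRp.isChain
  · exact head_sorted L hLp ps ((hL _).2 G.sA) (fun q hq => C.le_low (G.memA ((hL q).1 hq)))
  · exact head_sorted R hRp ps ((hR _).2 G.sB) (fun q hq => C.le_low (G.memB ((hR q).1 hq)))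
  · exact last_sorted L hLp pt ((hL _).2 G.tA) (fun q hq => C.le_high (G.memA ((hL q).1 hq)))
  · exact last_sorted R hRp pt ((hR _).2 G.tB) (fun q hq => C.le_high (G.memB ((hR q).1 hq)))
  · exact nodup_sorted L hLp
  · exact nodup_sorted R hRp
  · intro p; rw [hL, hR]; exact G.cover p
  · intro p h1 h2; exact G.shared p ((hL p).1 h1) ((hR p).1 h2)
  · intro e he f hf hne
    rcases List.mem_append.1 he with he | he <;> rcases List.mem_append.1 hf with hf | hf
    · exact segNC_same C.hy (fun _ h => G.memA h) (eL e he) (eL f hf) hne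
    · exact segNC_cross C G h3 (eL e he) (eR f hf)
    · intro x h1 h2
      exact (segNC_cross C G h3 (eL f hf) (eR e he) x h2 h1).symm
    · exact segNC_same C.hy (fun _ h => G.memB h) (eR e he) (eR f hf) hne
  · intro p hp q hq hpq h1 h2
    simp only [polyPts, Set.mem_iUnion] at hp hq
    obtain ⟨e, he, hp⟩ := hp
    obtain ⟨f, hf, hq⟩ := hq
    exact leftOf_edges C G h3 (eL e he) (eR f hf) hp hq hpq h1 h2
  · rw [← List.toFinset_card_of_nodup (nodup_sorted L hLp)]
    congr 1
    ext p; rw [List.mem_toFinset, hL]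
/-- for every `m` between the size of the left envelope and
`n - |E_R| + 2`, there is a non-crossing monotone Hamiltonian cycle whose left
path uses exactly `m` points. -/
theorem stmt_19 (S : Finset Pt) (n : ℕ) (hn : S.card = n) (h3 : 3 ≤ n)
    (hy : DistinctY S) (hgp : GenPos S)
    (ps pt : Pt) (hs : IsLowest S ps) (ht : IsHighest S pt)
    (m : ℕ)
    (hm1 : (leftEnvelope S ps pt).ncard ≤ m)
    (hm2 : m ≤ n - (rightEnvelope S ps pt).ncard + 2) :
    ∃ L R : List Pt, IsNCMonoHamCycle S ps pt L R ∧ LeftOf L R ps pt ∧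
      L.length = m := by

  have C : Cfg S ps pt := ⟨hy, hgp, hs, ht⟩
  subst hn
  have h3' : ∃ w ∈ S, w ≠ ps ∧ w ≠ pt := by
    have hlt : ({ps, pt} : Finset Pt).card < S.card :=
      lt_of_le_of_lt Finset.card_le_two h3
    obtain ⟨w, hw, hw'⟩ := Finset.exists_mem_notMem_of_card_lt_card hlt
    simp only [Finset.mem_insert, Finset.mem_singleton, not_or] at hw'
    exact ⟨w, hw, hw'.1, hw'.2⟩
  have hst : ps ≠ pt := by
    rintro rfl
    obtain ⟨w, hw, h1, -⟩ := h3'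
    have := hs.2 w hw h1
    have := ht.2 w hw h1
    linarith
  obtain ⟨A, B, G, hA⟩ := reach C hst m hm1 hm2
  obtain ⟨L, R, h1, h2, h4⟩ := realize C G h3'
  exact ⟨L, R, h1, h2, h4.trans hA⟩
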